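/- arXiv:2506.02647 — 6 statements merged into one kernel-verified Lean document; each statement's English description precedes it below -/
import Mathlib

section
/- Let α, β, γ, c₁, c₂, c₃ > 0 with β > γ and 2α ≥ min(β, γ). Then there exists a constant C > 0 such that for every ε with 0 < ε < e^{-1} there exist L ∈ ℕ and positive integers M_0, …, M_L satisfying Σ_{ℓ=0}^{L} c₂ 2^{-βℓ} / M_ℓ + (c₁ 2^{-αL})² ≤ ε² and Σ_{ℓ=0}^{L} M_ℓ c₃ 2^{γℓ} ≤ C ε^{-2}. -/
open scoped BigOperators

theorem mlmc_abstract (a b g r q c₁ c₂ c₃ : ℝ) (ha : 0 < a) (ha1 : a < 1) (hg : 1 < g)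
    (hr : 0 < r) (hq : 0 < q) (hq1 : q < 1) (hrg : r * g = q) (hb : b = r * q)
    (hga : g * a ^ 2 ≤ 1)
    (hc₁ : 0 < c₁) (hc₂ : 0 < c₂) (hc₃ : 0 < c₃) :
    ∃ C : ℝ, 0 < C ∧ ∀ ε : ℝ, 0 < ε → ε < 1 →
      ∃ (L : ℕ) (M : ℕ → ℕ),
        (∀ ℓ ≤ L, 0 < M ℓ)
        ∧ (∑ ℓ ∈ Finset.range (L + 1), c₂ * b ^ ℓ / (M ℓ : ℝ))
            + (c₁ * a ^ L) ^ 2 ≤ ε ^ 2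
        ∧ ∑ ℓ ∈ Finset.range (L + 1), (M ℓ : ℝ) * c₃ * g ^ ℓ
            ≤ C * (ε ^ 2)⁻¹ := by
  have hS : 0 < (1 - q)⁻¹ := inv_pos.2 (by linarith)
  set S := (1 - q)⁻¹ with hSdef
  have hg1 : 0 < g - 1 := by linarith
  have hg0 : 0 < g := by linarith
  have hD : 0 < 1 + 2 * c₁ ^ 2 * g := by positivity
  set D := 1 + 2 * c₁ ^ 2 * g with hDdef
  have hsum : ∀ n, ∑ ℓ ∈ Finset.range n, q ^ ℓ ≤ S := by
    intro n
    have := (summable_geometric_of_lt_one hq.le hq1).sum_le_tsum (Finset.range n)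
      (fun i _ => by positivity)
    rwa [tsum_geometric_of_lt_one hq.le hq1] at this
  refine ⟨c₃ * (2 * c₂ * S * S + D * g / (g - 1)), by positivity, ?_⟩
  intro ε hε hε1
  have hε2 : 0 < ε ^ 2 := by positivity
  have hex : ∃ L : ℕ, (c₁ * a ^ L) ^ 2 ≤ ε ^ 2 / 2 := by
    have h1 : Filter.Tendsto (fun L : ℕ => (c₁ * a ^ L) ^ 2) Filter.atTop (nhds ((c₁ * 0) ^ 2)) :=
      ((tendsto_pow_atTop_nhds_zero_of_lt_one ha.le ha1).const_mul c₁).pow 2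
    have h2 : (c₁ * 0) ^ 2 < ε ^ 2 / 2 := by
      have : 0 < ε ^ 2 / 2 := by positivity
      simpa using this
    obtain ⟨L, hL⟩ := (h1.eventually_lt_const h2).exists
    exact ⟨L, hL.le⟩
  obtain ⟨L, hL, hLg⟩ : ∃ L : ℕ, (c₁ * a ^ L) ^ 2 ≤ ε ^ 2 / 2 ∧ g ^ L * ε ^ 2 ≤ D := by
    classical
    refine ⟨Nat.find hex, Nat.find_spec hex, ?_⟩
    rcases hn : Nat.find hex with _ | n
    · have : 0 < 2 * c₁ ^ 2 * g := by positivity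
      rw [pow_zero]
      nlinarith
    · have h := Nat.find_min hex (m := n) (by omega)
      push Not at h
      have h1 : (g * a ^ 2) ^ n ≤ 1 := pow_le_one₀ (by positivity) hga
      have h2 : g ^ n * (ε ^ 2 / 2) ≤ g ^ n * (c₁ * a ^ n) ^ 2 := by gcongr
      have h3 : g ^ n * (c₁ * a ^ n) ^ 2 = c₁ ^ 2 * (g * a ^ 2) ^ n := by
        rw [mul_pow, mul_pow, ← pow_mul, ← pow_mul, mul_comm n 2]; ring
      have h4 : c₁ ^ 2 * (g * a ^ 2) ^ n ≤ c₁ ^ 2 * 1 := by gcongr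
      have h5 : g ^ n * (ε ^ 2 / 2) ≤ c₁ ^ 2 := by linarith
      have h6 := mul_le_mul_of_nonneg_left h5 hg0.le
      rw [pow_succ]
      nlinarith
  have hx : ∀ ℓ : ℕ, 0 < 2 * c₂ * S * (ε ^ 2)⁻¹ * r ^ ℓ := fun ℓ => by positivity
  refine ⟨L, fun ℓ => ⌈2 * c₂ * S * (ε ^ 2)⁻¹ * r ^ ℓ⌉₊, fun ℓ _ => Nat.ceil_pos.2 (hx ℓ), ?_, ?_⟩
  · have h1 : ∑ ℓ ∈ Finset.range (L + 1), c₂ * b ^ ℓ / (⌈2 * c₂ * S * (ε ^ 2)⁻¹ * r ^ ℓ⌉₊ : ℝ)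
        ≤ ∑ ℓ ∈ Finset.range (L + 1), ε ^ 2 / (2 * S) * q ^ ℓ := by
      refine Finset.sum_le_sum fun ℓ _ => ?_
      have hb0 : 0 < b := by rw [hb]; positivity
      calc c₂ * b ^ ℓ / (⌈2 * c₂ * S * (ε ^ 2)⁻¹ * r ^ ℓ⌉₊ : ℝ)
          ≤ c₂ * b ^ ℓ / (2 * c₂ * S * (ε ^ 2)⁻¹ * r ^ ℓ) :=
            div_le_div_of_nonneg_left (by positivity) (hx ℓ) (Nat.le_ceil _)
        _ = ε ^ 2 / (2 * S) * q ^ ℓ := by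
            rw [hb, mul_pow]
            clear_value S
            field_simp
    rw [← Finset.mul_sum] at h1
    have h2 : ε ^ 2 / (2 * S) * ∑ ℓ ∈ Finset.range (L + 1), q ^ ℓ ≤ ε ^ 2 / (2 * S) * S := by
      gcongr
      exact hsum _
    have h3 : ε ^ 2 / (2 * S) * S = ε ^ 2 / 2 := by
      clear_value S
      field_simp
    linarith
  · have h1 : ∑ ℓ ∈ Finset.range (L + 1), (⌈2 * c₂ * S * (ε ^ 2)⁻¹ * r ^ ℓ⌉₊ : ℝ) * c₃ * g ^ ℓ
        ≤ ∑ ℓ ∈ Finset.range (L + 1), (c₃ * (2 * c₂ * S * (ε ^ 2)⁻¹) * q ^ ℓ + c₃ * g ^ ℓ) := by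
      refine Finset.sum_le_sum fun ℓ _ => ?_
      calc (⌈2 * c₂ * S * (ε ^ 2)⁻¹ * r ^ ℓ⌉₊ : ℝ) * c₃ * g ^ ℓ
          ≤ (2 * c₂ * S * (ε ^ 2)⁻¹ * r ^ ℓ + 1) * c₃ * g ^ ℓ := by
            gcongr
            exact (Nat.ceil_lt_add_one (hx ℓ).le).le
        _ = _ := by rw [← hrg, mul_pow]; ring
    rw [Finset.sum_add_distrib, ← Finset.mul_sum, ← Finset.mul_sum, geom_sum_eq hg.ne'] at h1
    have h2 : c₃ * (2 * c₂ * S * (ε ^ 2)⁻¹) * ∑ ℓ ∈ Finset.range (L + 1), q ^ ℓ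
        ≤ c₃ * (2 * c₂ * S * (ε ^ 2)⁻¹) * S := by
      gcongr
      exact hsum _
    have h4 : g ^ L ≤ D * (ε ^ 2)⁻¹ := by
      rw [← div_eq_mul_inv, le_div_iff₀ hε2]; exact hLg
    have h3 : c₃ * ((g ^ (L + 1) - 1) / (g - 1)) ≤ c₃ * ((D * (ε ^ 2)⁻¹) * g / (g - 1)) := by
      gcongr
      rw [pow_succ]
      nlinarith
    calc _ ≤ _ := h1
      _ ≤ _ := add_le_add h2 h3
      _ = _ := by ring

/-- Multilevel Monte Carlo complexity theorem, case `β > γ`: root mean squared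
error `ε` is achievable at total cost `O(ε⁻²)`. -/
theorem mlmc_complexity_beta_gt_gamma
    (α β γ c₁ c₂ c₃ : ℝ) (hα : 0 < α) (hβ : 0 < β) (hγ : 0 < γ)
    (hc₁ : 0 < c₁) (hc₂ : 0 < c₂) (hc₃ : 0 < c₃)
    (hβγ : γ < β) (h2α : min β γ ≤ 2 * α) :
    ∃ C : ℝ, 0 < C ∧ ∀ ε : ℝ, 0 < ε → ε < Real.exp (-1) →
      ∃ (L : ℕ) (M : ℕ → ℕ),
        (∀ ℓ ≤ L, 0 < M ℓ)
        ∧ (∑ ℓ ∈ Finset.range (L + 1), c₂ * (2 : ℝ) ^ (-(β * ℓ)) / (M ℓ : ℝ))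
            + (c₁ * (2 : ℝ) ^ (-(α * L))) ^ 2 ≤ ε ^ 2
        ∧ ∑ ℓ ∈ Finset.range (L + 1), (M ℓ : ℝ) * c₃ * (2 : ℝ) ^ (γ * ℓ)
            ≤ C * (ε ^ 2)⁻¹ := by
  have h2 : (1 : ℝ) < 2 := by norm_num
  have h0 : (0 : ℝ) < 2 := by norm_num
  rw [min_eq_right hβγ.le] at h2α
  obtain ⟨C, hC, H⟩ := mlmc_abstract ((2 : ℝ) ^ (-α)) ((2 : ℝ) ^ (-β)) ((2 : ℝ) ^ γ)
    ((2 : ℝ) ^ (-(β + γ) / 2)) ((2 : ℝ) ^ (-(β - γ) / 2)) c₁ c₂ c₃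
    (by positivity) (Real.rpow_lt_one_of_one_lt_of_neg h2 (by linarith))
    (Real.one_lt_rpow h2 hγ) (by positivity) (by positivity)
    (Real.rpow_lt_one_of_one_lt_of_neg h2 (by linarith))
    (by rw [← Real.rpow_add h0]; congr 1; ring)
    (by rw [← Real.rpow_add h0]; congr 1; ring)
    (by
      rw [← Real.rpow_mul_natCast h0.le, ← Real.rpow_add h0]
      exact Real.rpow_le_one_of_one_le_of_nonpos h2.le (by push_cast; linarith))
    hc₁ hc₂ hc₃
  refine ⟨C, hC, fun ε hε hε1 => ?_⟩
  obtain ⟨L, M, hM, hV, hK⟩ := H ε hε (hε1.trans (by simp))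
  refine ⟨L, M, hM, ?_, ?_⟩
  · simpa only [← neg_mul, Real.rpow_mul_natCast h0.le] using hV
  · simpa only [Real.rpow_mul_natCast h0.le] using hK
end

section
/- Let α, β, γ, c₁, c₂, c₃ > 0 with β = γ and 2α ≥ min(β, γ). Then there exists a constant C > 0 such that for every ε with 0 < ε < e^{-1} there exist L ∈ ℕ and positive integers M_0, …, M_L satisfying Σ_{ℓ=0}^{L} c₂ 2^{-βℓ} / M_ℓ + (c₁ 2^{-αL})² ≤ ε² and Σ_{ℓ=0}^{L} M_ℓ c₃ 2^{γℓ} ≤ C ε^{-2} (log ε)². -/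
open scoped BigOperators

/-- Multilevel Monte Carlo complexity theorem, case `β = γ`: root mean squared
error `ε` is achievable at total cost `O(ε⁻² (log ε)²)`. -/
theorem mlmc_complexity_beta_eq_gamma
    (α β γ c₁ c₂ c₃ : ℝ) (hα : 0 < α) (hβ : 0 < β) (hγ : 0 < γ)
    (hc₁ : 0 < c₁) (hc₂ : 0 < c₂) (hc₃ : 0 < c₃)
    (hβγ : β = γ) (h2α : min β γ ≤ 2 * α) :
    ∃ C : ℝ, 0 < C ∧ ∀ ε : ℝ, 0 < ε → ε < Real.exp (-1) →
      ∃ (L : ℕ) (M : ℕ → ℕ),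
        (∀ ℓ ≤ L, 0 < M ℓ)
        ∧ (∑ ℓ ∈ Finset.range (L + 1), c₂ * (2 : ℝ) ^ (-(β * ℓ)) / (M ℓ : ℝ))
            + (c₁ * (2 : ℝ) ^ (-(α * L))) ^ 2 ≤ ε ^ 2
        ∧ ∑ ℓ ∈ Finset.range (L + 1), (M ℓ : ℝ) * c₃ * (2 : ℝ) ^ (γ * ℓ)
            ≤ C * (ε ^ 2)⁻¹ * (Real.log ε) ^ 2 := by
  subst hβγ
  have hβ2 : β ≤ 2 * α := by simpa using h2α
  have hl2 : 0 < Real.log 2 := Real.log_pos (by norm_num)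
  have hal : 0 < α * Real.log 2 := mul_pos hα hl2
  obtain ⟨B, hB⟩ : ∃ B : ℝ, B = 2 * c₁ + 1 := ⟨_, rfl⟩
  have hB1 : 1 < B := by linarith
  have hB0 : 0 < B := by linarith
  have hlB : 0 < Real.log B := Real.log_pos hB1
  obtain ⟨D, hD⟩ : ∃ D : ℝ, D = (Real.log B + 1) / (α * Real.log 2) + 2 := ⟨_, rfl⟩
  have hD0 : 0 < D := by rw [hD]; positivity
  obtain ⟨E, hE⟩ : ∃ E : ℝ, E = ((2 : ℝ) ^ α * B) ^ 2 := ⟨_, rfl⟩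
  have hE0 : 0 < E := by rw [hE]; positivity
  refine ⟨c₃ * (2 * c₂ + E) * D ^ 2, by positivity, ?_⟩
  intro ε hε hε1
  have hx : 1 < -Real.log ε := by
    have := (Real.log_lt_iff_lt_exp hε).2 hε1
    linarith
  obtain ⟨x, hxd⟩ : ∃ x : ℝ, x = -Real.log ε := ⟨_, rfl⟩
  rw [← hxd] at hx
  obtain ⟨y, hy⟩ : ∃ y : ℝ, y = (Real.log B + x) / (α * Real.log 2) := ⟨_, rfl⟩
  have hy0 : 0 < y := by rw [hy]; positivity
  have hpy : (2 : ℝ) ^ (α * y) = B / ε := by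
    rw [Real.rpow_def_of_pos (by norm_num)]
    have : Real.log 2 * (α * y) = Real.log (B / ε) := by
      rw [Real.log_div hB0.ne' hε.ne', hy, hxd]
      field_simp
      ring
    rw [this, Real.exp_log (by positivity)]
  obtain ⟨L, hL⟩ : ∃ L : ℕ, L = ⌈y⌉₊ := ⟨_, rfl⟩
  have hyL : y ≤ L := by rw [hL]; exact Nat.le_ceil y
  have hLy : (L : ℝ) < y + 1 := by rw [hL]; exact Nat.ceil_lt_add_one hy0.le
  have hLD : (L : ℝ) + 1 ≤ D * x := by
    have h1 : y ≤ (Real.log B + 1) / (α * Real.log 2) * x := by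
      rw [hy, div_mul_eq_mul_div]
      gcongr
      nlinarith
    rw [hD]
    nlinarith
  have hlow : B / ε ≤ (2 : ℝ) ^ (α * L) := by
    rw [← hpy]
    exact Real.rpow_le_rpow_of_exponent_le (by norm_num) (by gcongr)
  have hup : (2 : ℝ) ^ (α * L) ≤ (2 : ℝ) ^ α * B / ε := by
    rw [mul_div_assoc, ← hpy, ← Real.rpow_add (by norm_num)]
    exact Real.rpow_le_rpow_of_exponent_le (by norm_num) (by nlinarith)
  have hlev : ∀ ℓ ≤ L, (2 : ℝ) ^ (β * ℓ) ≤ E * (ε ^ 2)⁻¹ := by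
    intro ℓ hℓ
    have hℓ' : (ℓ : ℝ) ≤ L := by exact_mod_cast hℓ
    calc (2 : ℝ) ^ (β * ℓ) ≤ (2 : ℝ) ^ (α * L + α * L) := by
          apply Real.rpow_le_rpow_of_exponent_le (by norm_num)
          have : β * ℓ ≤ (2 * α) * L := by gcongr
          linarith
      _ = ((2 : ℝ) ^ (α * L)) ^ 2 := by rw [Real.rpow_add (by norm_num), sq]
      _ ≤ ((2 : ℝ) ^ α * B / ε) ^ 2 := by gcongr
      _ = E * (ε ^ 2)⁻¹ := by rw [hE, div_pow, div_eq_mul_inv]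
  have hMpos : ∀ ℓ : ℕ, 0 < 2 * c₂ * ((L : ℝ) + 1) * (ε ^ 2)⁻¹ * (2 : ℝ) ^ (-(β * ℓ)) := by
    intro ℓ; positivity
  refine ⟨L, fun ℓ => ⌈2 * c₂ * ((L : ℝ) + 1) * (ε ^ 2)⁻¹ * (2 : ℝ) ^ (-(β * ℓ))⌉₊, ?_, ?_, ?_⟩
  · intro ℓ _
    exact Nat.ceil_pos.2 (hMpos ℓ)
  · have hvar : ∑ ℓ ∈ Finset.range (L + 1), c₂ * (2 : ℝ) ^ (-(β * ℓ)) /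
        ((⌈2 * c₂ * ((L : ℝ) + 1) * (ε ^ 2)⁻¹ * (2 : ℝ) ^ (-(β * ℓ))⌉₊ : ℕ) : ℝ)
        ≤ ∑ ℓ ∈ Finset.range (L + 1), ε ^ 2 / (2 * ((L : ℝ) + 1)) := by
      apply Finset.sum_le_sum
      intro ℓ _
      have h2 : (0 : ℝ) < (2 : ℝ) ^ (-(β * ℓ)) := by positivity
      calc _ ≤ c₂ * (2 : ℝ) ^ (-(β * ℓ)) /
            (2 * c₂ * ((L : ℝ) + 1) * (ε ^ 2)⁻¹ * (2 : ℝ) ^ (-(β * ℓ))) :=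
            div_le_div_of_nonneg_left (by positivity) (hMpos ℓ) (Nat.le_ceil _)
        _ = _ := by field_simp
    have hs : ∑ ℓ ∈ Finset.range (L + 1), ε ^ 2 / (2 * ((L : ℝ) + 1)) = ε ^ 2 / 2 := by
      rw [Finset.sum_const, Finset.card_range, nsmul_eq_mul]
      push_cast
      field_simp
    have hb : c₁ * (2 : ℝ) ^ (-(α * L)) ≤ ε / 2 := by
      rw [Real.rpow_neg (by norm_num), ← div_eq_mul_inv, div_le_iff₀ (by positivity)]
      calc c₁ ≤ B / 2 := by linarith
        _ = ε / 2 * (B / ε) := by field_simp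
        _ ≤ _ := by gcongr
    have hb2 : (c₁ * (2 : ℝ) ^ (-(α * L))) ^ 2 ≤ (ε / 2) ^ 2 := by gcongr
    nlinarith [sq_nonneg ε]
  · have hx2 : Real.log ε ^ 2 = x ^ 2 := by rw [hxd]; ring
    rw [hx2]
    have hL1 : (1 : ℝ) ≤ (L : ℝ) + 1 := by linarith [Nat.cast_nonneg (α := ℝ) L]
    have hcost : ∀ ℓ ∈ Finset.range (L + 1),
        ((⌈2 * c₂ * ((L : ℝ) + 1) * (ε ^ 2)⁻¹ * (2 : ℝ) ^ (-(β * ℓ))⌉₊ : ℕ) : ℝ) * c₃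
          * (2 : ℝ) ^ (β * ℓ) ≤ c₃ * (2 * c₂ + E) * ((L : ℝ) + 1) * (ε ^ 2)⁻¹ := by
      intro ℓ hℓ
      have hℓ' : ℓ ≤ L := by simpa [Nat.lt_succ_iff] using hℓ
      have h1 := (Nat.ceil_lt_add_one (hMpos ℓ).le).le
      have h2 : (2 : ℝ) ^ (-(β * ℓ)) * (2 : ℝ) ^ (β * ℓ) = 1 := by
        rw [← Real.rpow_add (by norm_num)]; simp
      have h3 : E * (ε ^ 2)⁻¹ ≤ E * (ε ^ 2)⁻¹ * ((L : ℝ) + 1) :=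
        le_mul_of_one_le_right (by positivity) hL1
      calc _ ≤ (2 * c₂ * ((L : ℝ) + 1) * (ε ^ 2)⁻¹ * (2 : ℝ) ^ (-(β * ℓ)) + 1) * c₃
            * (2 : ℝ) ^ (β * ℓ) := by gcongr
        _ = c₃ * (2 * c₂ * ((L : ℝ) + 1) * (ε ^ 2)⁻¹
            * ((2 : ℝ) ^ (-(β * ℓ)) * (2 : ℝ) ^ (β * ℓ)) + (2 : ℝ) ^ (β * ℓ)) := by ring
        _ ≤ c₃ * (2 * c₂ * ((L : ℝ) + 1) * (ε ^ 2)⁻¹ * 1 + E * (ε ^ 2)⁻¹ * ((L : ℝ) + 1)) := by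
            rw [h2]
            have := (hlev ℓ hℓ').trans h3
            gcongr
        _ = _ := by ring
    calc _ ≤ ∑ ℓ ∈ Finset.range (L + 1), c₃ * (2 * c₂ + E) * ((L : ℝ) + 1) * (ε ^ 2)⁻¹ :=
          Finset.sum_le_sum hcost
      _ = c₃ * (2 * c₂ + E) * (ε ^ 2)⁻¹ * ((L : ℝ) + 1) ^ 2 := by
          rw [Finset.sum_const, Finset.card_range, nsmul_eq_mul]
          push_cast
          ring
      _ ≤ c₃ * (2 * c₂ + E) * (ε ^ 2)⁻¹ * (D * x) ^ 2 := by gcongr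
      _ = _ := by ring
end

section
/- Let α, β, γ, c₁, c₂, c₃ > 0 with β < γ and 2α ≥ min(β, γ). Then there exists a constant C > 0 such that for every ε with 0 < ε < e^{-1} there exist L ∈ ℕ and positive integers M_0, …, M_L satisfying Σ_{ℓ=0}^{L} c₂ 2^{-βℓ} / M_ℓ + (c₁ 2^{-αL})² ≤ ε² and Σ_{ℓ=0}^{L} M_ℓ c₃ 2^{γℓ} ≤ C ε^{-2-(γ-β)/α}. -/
open scoped BigOperators

lemma mlmc_geom (δ : ℝ) (hδ : 0 < δ) : ∃ S : ℝ, 0 < S ∧ ∀ L : ℕ,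
    ∑ ℓ ∈ Finset.range (L + 1), (2 : ℝ) ^ (δ * ℓ) ≤ S * (2 : ℝ) ^ (δ * L) := by
  have hr : (2 : ℝ) ^ (-δ) < 1 := Real.rpow_lt_one_of_one_lt_of_neg (by norm_num) (by linarith)
  have hd : 0 < 1 - (2 : ℝ) ^ (-δ) := by linarith
  refine ⟨1 / (1 - (2 : ℝ) ^ (-δ)), by positivity, fun L => ?_⟩
  induction L with
  | zero =>
    have : 0 < (2 : ℝ) ^ (-δ) := by positivity
    simp only [zero_add, Finset.sum_range_one, Nat.cast_zero, mul_zero, Real.rpow_zero, mul_one]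
    rw [le_div_iff₀ hd]
    linarith
  | succ n ih =>
    rw [Finset.sum_range_succ]
    have h : (2 : ℝ) ^ (δ * n) = (2 : ℝ) ^ (δ * (n + 1 : ℕ)) * (2 : ℝ) ^ (-δ) := by
      rw [← Real.rpow_add (by norm_num)]
      congr 1
      push_cast
      ring
    rw [h] at ih
    refine (add_le_add_left ih _).trans (le_of_eq ?_)
    field_simp
    ring

lemma mlmc_level (α c₁ : ℝ) (hα : 0 < α) (hc₁ : 0 < c₁) : ∃ K : ℝ, 0 < K ∧
    ∀ ε : ℝ, 0 < ε → ε < 1 → ∃ L : ℕ, c₁ * (2 : ℝ) ^ (-(α * L)) ≤ ε / 2 ∧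
      ∀ t : ℝ, 0 ≤ t → (2 : ℝ) ^ (t * L) ≤ ((2 : ℝ) ^ t * K ^ (t / α)) * ε ^ (-(t / α)) := by
  have hK : 0 < max (2 * c₁) 1 := by positivity
  refine ⟨max (2 * c₁) 1, hK, fun ε h0 h1 => ?_⟩
  set K := max (2 * c₁) 1 with hKd
  have hK1 : 1 ≤ K := le_max_right _ _
  have hK2 : 2 * c₁ ≤ K := le_max_left _ _
  have hy : 1 ≤ K / ε := by rw [le_div_iff₀ h0]; linarith
  have hy0 : 0 < K / ε := by positivity
  set x := Real.logb 2 (K / ε) / α with hx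
  have hx0 : 0 ≤ x := div_nonneg (Real.logb_nonneg (by norm_num) hy) hα.le
  have key : ∀ t : ℝ, (2 : ℝ) ^ (t * x) = (K / ε) ^ (t / α) := by
    intro t
    have : t * x = Real.logb 2 (K / ε) * (t / α) := by rw [hx]; ring
    rw [this, Real.rpow_mul (by norm_num), Real.rpow_logb (by norm_num) (by norm_num) hy0]
  refine ⟨⌈x⌉₊, ?_, fun t ht => ?_⟩
  · have h : (2 : ℝ) ^ (α * x) ≤ (2 : ℝ) ^ (α * (⌈x⌉₊ : ℝ)) :=
      Real.rpow_le_rpow_of_exponent_le (by norm_num)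
        (mul_le_mul_of_nonneg_left (Nat.le_ceil x) hα.le)
    rw [key, div_self hα.ne', Real.rpow_one, div_le_iff₀ h0] at h
    rw [Real.rpow_neg (by norm_num), ← div_eq_mul_inv, div_le_iff₀ (by positivity)]
    linarith
  · have h : (2 : ℝ) ^ (t * (⌈x⌉₊ : ℝ)) ≤ (2 : ℝ) ^ (t + t * x) := by
      apply Real.rpow_le_rpow_of_exponent_le (by norm_num)
      have := mul_le_mul_of_nonneg_left (Nat.ceil_lt_add_one hx0).le ht
      linarith
    refine h.trans (le_of_eq ?_)
    rw [Real.rpow_add (by norm_num), key, Real.div_rpow hK.le h0.le, Real.rpow_neg h0.le]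
    ring

/-- Multilevel Monte Carlo complexity theorem, case `β < γ`: root mean squared
error `ε` is achievable at total cost `O(ε^{-2-(γ-β)/α})`. -/
theorem mlmc_complexity_beta_lt_gamma
    (α β γ c₁ c₂ c₃ : ℝ) (hα : 0 < α) (hβ : 0 < β) (hγ : 0 < γ)
    (hc₁ : 0 < c₁) (hc₂ : 0 < c₂) (hc₃ : 0 < c₃)
    (hβγ : β < γ) (h2α : min β γ ≤ 2 * α) :
    ∃ C : ℝ, 0 < C ∧ ∀ ε : ℝ, 0 < ε → ε < Real.exp (-1) →
      ∃ (L : ℕ) (M : ℕ → ℕ),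
        (∀ ℓ ≤ L, 0 < M ℓ)
        ∧ (∑ ℓ ∈ Finset.range (L + 1), c₂ * (2 : ℝ) ^ (-(β * ℓ)) / (M ℓ : ℝ))
            + (c₁ * (2 : ℝ) ^ (-(α * L))) ^ 2 ≤ ε ^ 2
        ∧ ∑ ℓ ∈ Finset.range (L + 1), (M ℓ : ℝ) * c₃ * (2 : ℝ) ^ (γ * ℓ)
            ≤ C * ε ^ (-(2 + (γ - β) / α)) := by
  rw [min_eq_left hβγ.le] at h2α
  obtain ⟨δ, hδ⟩ : ∃ δ : ℝ, δ = (γ - β) / 2 := ⟨_, rfl⟩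
  have hδ0 : 0 < δ := by rw [hδ]; linarith
  obtain ⟨S, hS, hSs⟩ := mlmc_geom δ hδ0
  obtain ⟨T, hT, hTs⟩ := mlmc_geom γ hγ
  obtain ⟨K, hK, hL⟩ := mlmc_level α c₁ hα hc₁
  obtain ⟨A, hA⟩ : ∃ A : ℝ, A = (2 : ℝ) ^ γ * K ^ (γ / α) := ⟨_, rfl⟩
  obtain ⟨B, hB⟩ : ∃ B : ℝ, B = (2 : ℝ) ^ (γ - β) * K ^ ((γ - β) / α) := ⟨_, rfl⟩
  have hA0 : 0 < A := by rw [hA]; positivity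
  have hB0 : 0 < B := by rw [hB]; positivity
  refine ⟨c₃ * T * A + 2 * c₂ * c₃ * S * S * B, by positivity, fun ε h0 he => ?_⟩
  have h1 : ε < 1 := he.trans (by simp)
  obtain ⟨L, hLb, hLt⟩ := hL ε h0 h1
  have hLA := hLt γ hγ.le
  have hLB := hLt (γ - β) (by linarith)
  rw [← hA] at hLA
  rw [← hB] at hLB
  obtain ⟨m, hm⟩ : ∃ m : ℕ → ℝ, m = fun ℓ : ℕ =>
    2 * c₂ * S / ε ^ 2 * (2 : ℝ) ^ (δ * L) * (2 : ℝ) ^ (-((β + γ) / 2 * ℓ)) := ⟨_, rfl⟩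
  have hm0 : ∀ ℓ, 0 < m ℓ := fun ℓ => by rw [hm]; positivity
  refine ⟨L, fun ℓ => ⌈m ℓ⌉₊, fun ℓ _ => Nat.ceil_pos.2 (hm0 ℓ), ?_, ?_⟩
  · have hvar : ∑ ℓ ∈ Finset.range (L + 1), c₂ * (2 : ℝ) ^ (-(β * ℓ)) / (⌈m ℓ⌉₊ : ℝ)
        ≤ ε ^ 2 / 2 := by
      have hP : 0 < (2 : ℝ) ^ (δ * L) := by positivity
      calc _ ≤ ∑ ℓ ∈ Finset.range (L + 1),
              ε ^ 2 / (2 * S * (2 : ℝ) ^ (δ * L)) * (2 : ℝ) ^ (δ * ℓ) := by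
            apply Finset.sum_le_sum
            intro ℓ _
            refine (div_le_div_of_nonneg_left (by positivity) (hm0 ℓ) (Nat.le_ceil _)).trans
              (le_of_eq ?_)
            have h : (2 : ℝ) ^ (-(β * ℓ)) =
                (2 : ℝ) ^ (δ * ℓ) * (2 : ℝ) ^ (-((β + γ) / 2 * ℓ)) := by
              rw [← Real.rpow_add (by norm_num)]
              congr 1
              rw [hδ]
              ring
            have hQ : 0 < (2 : ℝ) ^ (-((β + γ) / 2 * ℓ)) := by positivity
            rw [h, hm]
            dsimp only
            generalize (2 : ℝ) ^ (-((β + γ) / 2 * ℓ)) = Q at *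
            generalize (2 : ℝ) ^ (δ * L) = P at *
            field_simp
        _ ≤ ε ^ 2 / (2 * S * (2 : ℝ) ^ (δ * L)) * (S * (2 : ℝ) ^ (δ * L)) := by
            rw [← Finset.mul_sum]
            exact mul_le_mul_of_nonneg_left (hSs L) (by positivity)
        _ = ε ^ 2 / 2 := by
            generalize (2 : ℝ) ^ (δ * L) = P at *
            field_simp
    have hb : (c₁ * (2 : ℝ) ^ (-(α * L))) ^ 2 ≤ (ε / 2) ^ 2 :=
      pow_le_pow_left₀ (by positivity) hLb 2
    nlinarith [sq_nonneg ε]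
  · have hE1 : ε ^ (-(γ / α)) ≤ ε ^ (-(2 + (γ - β) / α)) := by
      apply Real.rpow_le_rpow_of_exponent_ge h0 h1.le
      have : γ / α ≤ 2 + (γ - β) / α := by
        have : β / α ≤ 2 := by rw [div_le_iff₀ hα]; exact h2α
        rw [sub_div]
        linarith
      linarith
    have hE2 : ε ^ (-((γ - β) / α)) / ε ^ 2 = ε ^ (-(2 + (γ - β) / α)) := by
      rw [neg_add, Real.rpow_add h0, Real.rpow_neg h0.le 2, Real.rpow_two]
      ring
    have hPP : (2 : ℝ) ^ (δ * L) * (2 : ℝ) ^ (δ * L) = (2 : ℝ) ^ ((γ - β) * L) := by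
      rw [← Real.rpow_add (by norm_num)]
      congr 1
      rw [hδ]
      ring
    calc _ ≤ ∑ ℓ ∈ Finset.range (L + 1), (c₃ * (2 : ℝ) ^ (γ * ℓ) +
            2 * c₂ * c₃ * S / ε ^ 2 * (2 : ℝ) ^ (δ * L) * (2 : ℝ) ^ (δ * ℓ)) := by
          apply Finset.sum_le_sum
          intro ℓ _
          have h : (2 : ℝ) ^ (δ * ℓ) =
              (2 : ℝ) ^ (-((β + γ) / 2 * ℓ)) * (2 : ℝ) ^ (γ * ℓ) := by
            rw [← Real.rpow_add (by norm_num)]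
            congr 1
            rw [hδ]
            ring
          have h2 : (⌈m ℓ⌉₊ : ℝ) * (c₃ * (2 : ℝ) ^ (γ * ℓ)) ≤
              (m ℓ + 1) * (c₃ * (2 : ℝ) ^ (γ * ℓ)) :=
            mul_le_mul_of_nonneg_right (Nat.ceil_lt_add_one (hm0 ℓ).le).le (by positivity)
          rw [mul_assoc]
          refine h2.trans (le_of_eq ?_)
          rw [h, hm]
          ring
      _ ≤ c₃ * (T * (2 : ℝ) ^ (γ * L)) +
            2 * c₂ * c₃ * S / ε ^ 2 * (2 : ℝ) ^ (δ * L) * (S * (2 : ℝ) ^ (δ * L)) := by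
          rw [Finset.sum_add_distrib, ← Finset.mul_sum, ← Finset.mul_sum]
          exact add_le_add (mul_le_mul_of_nonneg_left (hTs L) hc₃.le)
            (mul_le_mul_of_nonneg_left (hSs L) (by positivity))
      _ = c₃ * T * (2 : ℝ) ^ (γ * L) +
            2 * c₂ * c₃ * S * S / ε ^ 2 * (2 : ℝ) ^ ((γ - β) * L) := by
          rw [← hPP]
          ring
      _ ≤ c₃ * T * (A * ε ^ (-(2 + (γ - β) / α))) +
            2 * c₂ * c₃ * S * S / ε ^ 2 * (B * ε ^ (-((γ - β) / α))) := by
          apply add_le_add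
          · exact mul_le_mul_of_nonneg_left
              (hLA.trans (mul_le_mul_of_nonneg_left hE1 hA0.le)) (by positivity)
          · exact mul_le_mul_of_nonneg_left hLB (by positivity)
      _ = _ := by
          rw [← hE2]
          ring
end

section
/- Let α, γ, c₁, c₂, c₃ > 0. Then there exists a constant C > 0 such that for every ε with 0 < ε < 1 there exist ℓ ∈ ℕ and a positive integer M satisfying c₂ / M + (c₁ 2^{-αℓ})² ≤ ε² and M c₃ 2^{γℓ} ≤ C ε^{-2-γ/α}. -/
/-- Complexity of the standard (single-level) Monte Carlo finite element
method: accuracy `ε` is achievable at total cost `O(ε^{-2-γ/α})`. -/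
theorem mc_complexity
    (α γ c₁ c₂ c₃ : ℝ) (hα : 0 < α) (hγ : 0 < γ)
    (hc₁ : 0 < c₁) (hc₂ : 0 < c₂) (hc₃ : 0 < c₃) :
    ∃ C : ℝ, 0 < C ∧ ∀ ε : ℝ, 0 < ε → ε < 1 →
      ∃ (ℓ : ℕ) (M : ℕ), 0 < M
        ∧ c₂ / (M : ℝ) + (c₁ * (2 : ℝ) ^ (-(α * ℓ))) ^ 2 ≤ ε ^ 2
        ∧ (M : ℝ) * c₃ * (2 : ℝ) ^ (γ * ℓ) ≤ C * ε ^ (-(2 + γ / α)) := by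
  obtain ⟨K, hK⟩ : ∃ K : ℝ, K = 2 * c₁ + 1 := ⟨_, rfl⟩
  have hK0 : 0 < K := by linarith
  refine ⟨(2 * c₂ + 1) * c₃ * ((2 : ℝ) ^ γ * K ^ (γ / α)), by positivity, ?_⟩
  intro ε h0 h1
  have hx0 : 0 < K / ε := by positivity
  have hx1 : 1 ≤ K / ε := by
    rw [le_div_iff₀ h0]; linarith
  obtain ⟨b, hb⟩ : ∃ b : ℝ, b = Real.logb 2 (K / ε) := ⟨_, rfl⟩
  have hb0 : 0 ≤ b := by rw [hb]; exact Real.logb_nonneg (by norm_num) hx1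
  have h2b : (2 : ℝ) ^ b = K / ε := by
    rw [hb]; exact Real.rpow_logb (by norm_num) (by norm_num) hx0
  have hε2 : 0 < ε ^ 2 := by positivity
  have hM1 : 2 * c₂ / ε ^ 2 ≤ (⌈2 * c₂ / ε ^ 2⌉₊ : ℝ) := Nat.le_ceil _
  have hM2 : (⌈2 * c₂ / ε ^ 2⌉₊ : ℝ) < 2 * c₂ / ε ^ 2 + 1 :=
    Nat.ceil_lt_add_one (by positivity)
  have hL1 : b / α ≤ (⌈b / α⌉₊ : ℝ) := Nat.le_ceil _
  have hL2 : (⌈b / α⌉₊ : ℝ) < b / α + 1 := Nat.ceil_lt_add_one (by positivity)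
  refine ⟨⌈b / α⌉₊, ⌈2 * c₂ / ε ^ 2⌉₊, Nat.ceil_pos.2 (by positivity), ?_, ?_⟩
  · have hMpos : (0 : ℝ) < (⌈2 * c₂ / ε ^ 2⌉₊ : ℝ) := lt_of_lt_of_le (by positivity) hM1
    have e1 : c₂ / (⌈2 * c₂ / ε ^ 2⌉₊ : ℝ) ≤ ε ^ 2 / 2 := by
      rw [div_le_iff₀ hMpos]
      rw [div_le_iff₀ hε2] at hM1
      linarith
    have e2 : (2 : ℝ) ^ (-(α * (⌈b / α⌉₊ : ℝ))) ≤ ε / K := by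
      have : ε / K = (2 : ℝ) ^ (-b) := by
        rw [Real.rpow_neg (by norm_num), h2b, inv_div]
      rw [this]
      apply Real.rpow_le_rpow_of_exponent_le (by norm_num)
      rw [div_le_iff₀ hα] at hL1
      linarith
    have e3 : c₁ * (2 : ℝ) ^ (-(α * (⌈b / α⌉₊ : ℝ))) ≤ ε / 2 := by
      calc _ ≤ c₁ * (ε / K) := by gcongr
        _ ≤ ε / 2 := by
          rw [← mul_div_assoc, div_le_div_iff₀ hK0 (by norm_num)]
          nlinarith
    have e4 : (c₁ * (2 : ℝ) ^ (-(α * (⌈b / α⌉₊ : ℝ)))) ^ 2 ≤ (ε / 2) ^ 2 := by gcongr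
    nlinarith
  · have f1 : (⌈2 * c₂ / ε ^ 2⌉₊ : ℝ) ≤ (2 * c₂ + 1) * ε ^ (-2 : ℝ) := by
      have : ε ^ (-2 : ℝ) = 1 / ε ^ 2 := by
        rw [Real.rpow_neg h0.le, one_div]; norm_num
      rw [this]
      have h3 : 1 ≤ 1 / ε ^ 2 := by
        rw [le_div_iff₀ hε2]; nlinarith
      have h4 : (2 * c₂ + 1) * (1 / ε ^ 2) = 2 * c₂ / ε ^ 2 + 1 / ε ^ 2 := by ring
      linarith
    have f2 : (2 : ℝ) ^ (γ * (⌈b / α⌉₊ : ℝ)) ≤ (2 : ℝ) ^ γ * K ^ (γ / α) * ε ^ (-(γ / α)) := by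
      calc _ ≤ (2 : ℝ) ^ (γ + b * (γ / α)) := by
            apply Real.rpow_le_rpow_of_exponent_le (by norm_num)
            have : γ + b * (γ / α) = γ * (b / α + 1) := by ring
            rw [this]; gcongr
        _ = _ := by
            rw [Real.rpow_add (by norm_num), Real.rpow_mul (by norm_num), h2b,
              Real.div_rpow hK0.le h0.le, Real.rpow_neg h0.le]
            ring
    have f3 : ε ^ (-(2 + γ / α)) = ε ^ (-2 : ℝ) * ε ^ (-(γ / α)) := by
      rw [← Real.rpow_add h0]; congr 1; ring
    calc _ ≤ ((2 * c₂ + 1) * ε ^ (-2 : ℝ)) * c₃ *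
          ((2 : ℝ) ^ γ * K ^ (γ / α) * ε ^ (-(γ / α))) := by gcongr
      _ = _ := by rw [f3]; ring
end

section
/- Let H be a real inner product space, let z, z⁺, z*, G, r ∈ H, and let t ≥ 0, μ > 0, c_Lip ≥ 0, η ≥ 0 be real numbers. Assume ⟨G, z − z*⟩ ≥ μ ‖z − z*‖², ‖G‖ ≤ c_Lip ‖z − z*‖, ‖r‖ ≤ η ‖z − z*‖, and ‖z⁺ − z*‖ ≤ ‖z − t(G + r) − z*‖. Then ‖z⁺ − z*‖² ≤ (1 − 2(μ − η) t + (c_Lip + η)² t²) ‖z − z*‖². -/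
open scoped RealInnerProductSpace

/-- One-step contraction estimate for projected (stochastic) gradient descent
with an inexact gradient `G + r`: `G` is strongly monotone relative to the
minimizer `z*` and Lipschitz-bounded, `r` has a relative error bound, and the
projection is nonexpansive. -/
theorem sgd_one_step_contraction
    {H : Type*} [NormedAddCommGroup H] [InnerProductSpace ℝ H]
    (z zp zs G r : H) (t μ cLip η : ℝ)
    (ht : 0 ≤ t) (hμ : 0 < μ) (hc : 0 ≤ cLip) (hη : 0 ≤ η)
    (hmono : μ * ‖z - zs‖ ^ 2 ≤ ⟪G, z - zs⟫)
    (hG : ‖G‖ ≤ cLip * ‖z - zs‖)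
    (hr : ‖r‖ ≤ η * ‖z - zs‖)
    (hproj : ‖zp - zs‖ ≤ ‖z - t • (G + r) - zs‖) :
    ‖zp - zs‖ ^ 2
      ≤ (1 - 2 * (μ - η) * t + (cLip + η) ^ 2 * t ^ 2) * ‖z - zs‖ ^ 2 := by
  have e : z - t • (G + r) - zs = (z - zs) - t • (G + r) := by abel
  rw [e] at hproj
  generalize z - zs = d at *
  have h1 : ‖zp - zs‖ ^ 2 ≤ ‖d - t • (G + r)‖ ^ 2 :=
    pow_le_pow_left₀ (norm_nonneg _) hproj 2
  have h2 : ‖d - t • (G + r)‖ ^ 2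
      = ‖d‖ ^ 2 - 2 * (t * (⟪G, d⟫ + ⟪r, d⟫)) + t ^ 2 * ‖G + r‖ ^ 2 := by
    rw [norm_sub_sq_real, real_inner_smul_right, real_inner_comm, inner_add_left, norm_smul,
      mul_pow, Real.norm_eq_abs, sq_abs]
  have h3 : ‖G + r‖ ≤ (cLip + η) * ‖d‖ := by
    have := norm_add_le G r
    linarith
  have h4 : ‖G + r‖ ^ 2 ≤ ((cLip + η) * ‖d‖) ^ 2 :=
    pow_le_pow_left₀ (norm_nonneg _) h3 2
  have h5 : -(η * ‖d‖ ^ 2) ≤ ⟪r, d⟫ := by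
    have a := (abs_le.mp (abs_real_inner_le_norm r d)).1
    have b := mul_le_mul_of_nonneg_right hr (norm_nonneg d)
    nlinarith
  have h6 : t * ((μ - η) * ‖d‖ ^ 2) ≤ t * (⟪G, d⟫ + ⟪r, d⟫) :=
    mul_le_mul_of_nonneg_left (by linarith) ht
  have h7 := mul_le_mul_of_nonneg_left h4 (sq_nonneg t)
  rw [h2] at h1
  linarith
end

section
/- Let H be a real inner product space, let J : H → ℝ have a gradient ∇J(z) at every z ∈ H, and let μ, c_Lip, η be real numbers with 0 < μ ≤ c_Lip and 0 ≤ η < μ. Assume ⟨∇J(a) − ∇J(b), a − b⟩ ≥ μ ‖a − b‖² and ‖∇J(a) − ∇J(b)‖ ≤ c_Lip ‖a − b‖ for all a, b ∈ H, and let z* ∈ H satisfy ∇J(z*) = 0. Let (z_k)_{k≥0} and (r_k)_{k≥0} be sequences in H with z_{k+1} = z_k − t (∇J(z_k) + r_k) and ‖r_k‖ ≤ η ‖z_k − z*‖ for all k, where t = (μ − η)/(c_Lip + η)². Then for every K ∈ ℕ, ‖z_K − z*‖ ≤ ρ^K ‖z_0 − z*‖, where ρ = √(1 − (μ − η)²/(c_Lip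 + η)²) ∈ [0, 1). -/
open scoped RealInnerProductSpace

/-- Linear convergence of gradient descent with inexact gradients whose error
is bounded by a fixed fraction `η` of the current distance to the minimizer,
with the step size minimizing the per-step contraction factor. -/
theorem inexact_gradient_descent_linear_convergence
    {H : Type*} [NormedAddCommGroup H] [InnerProductSpace ℝ H]
    (J : H → ℝ) (J' : H → H)
    (hgrad : ∀ z, HasFDerivAt J (innerSL ℝ (J' z)) z)
    (μ cLip η : ℝ) (hμ : 0 < μ) (hμc : μ ≤ cLip) (hη : 0 ≤ η) (hημ : η < μ)
    (hmono : ∀ a b, μ * ‖a - b‖ ^ 2 ≤ ⟪J' a - J' b, a - b⟫)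
    (hLip : ∀ a b, ‖J' a - J' b‖ ≤ cLip * ‖a - b‖)
    (zs : H) (hzs : J' zs = 0)
    (z r : ℕ → H) (t : ℝ) (ht : t = (μ - η) / (cLip + η) ^ 2)
    (hiter : ∀ k, z (k + 1) = z k - t • (J' (z k) + r k))
    (herr : ∀ k, ‖r k‖ ≤ η * ‖z k - zs‖) :
    (0 ≤ Real.sqrt (1 - (μ - η) ^ 2 / (cLip + η) ^ 2)
      ∧ Real.sqrt (1 - (μ - η) ^ 2 / (cLip + η) ^ 2) < 1)
    ∧ ∀ K : ℕ, ‖z K - zs‖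
        ≤ Real.sqrt (1 - (μ - η) ^ 2 / (cLip + η) ^ 2) ^ K * ‖z 0 - zs‖ := by
  have hc : 0 < cLip + η := by linarith
  have hm : 0 < μ - η := by linarith
  have hc2 : 0 < (cLip + η) ^ 2 := by positivity
  have hq0 : 0 < (μ - η) ^ 2 / (cLip + η) ^ 2 := by positivity
  have hq1 : (μ - η) ^ 2 / (cLip + η) ^ 2 ≤ 1 := by
    rw [div_le_one hc2]
    exact pow_le_pow_left₀ hm.le (by linarith) 2
  have ht0 : 0 ≤ t := by rw [ht]; positivity
  refine ⟨⟨Real.sqrt_nonneg _, ?_⟩, ?_⟩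
  · rw [Real.sqrt_lt' one_pos]; linarith
  have step : ∀ k, ‖z (k + 1) - zs‖
      ≤ Real.sqrt (1 - (μ - η) ^ 2 / (cLip + η) ^ 2) * ‖z k - zs‖ := by
    intro k
    have h1 := hmono (z k) zs
    have h2 := hLip (z k) zs
    have h3 := herr k
    rw [hzs, sub_zero] at h1 h2
    have e : z (k + 1) - zs = (z k - zs) - t • (J' (z k) + r k) := by
      rw [hiter]; abel
    have hn : ‖J' (z k) + r k‖ ≤ (cLip + η) * ‖z k - zs‖ := by
      have := norm_add_le (J' (z k)) (r k)
      linarith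
    have hn2 : ‖J' (z k) + r k‖ ^ 2 ≤ (cLip + η) ^ 2 * ‖z k - zs‖ ^ 2 := by
      rw [← mul_pow]
      exact pow_le_pow_left₀ (norm_nonneg _) hn 2
    have hi : (μ - η) * ‖z k - zs‖ ^ 2 ≤ ⟪z k - zs, J' (z k) + r k⟫ := by
      rw [real_inner_comm, inner_add_left]
      have h4 := (abs_le.mp (abs_real_inner_le_norm (r k) (z k - zs))).1
      have h5 := mul_le_mul_of_nonneg_right h3 (norm_nonneg (z k - zs))
      nlinarith
    have hsq : ‖z (k + 1) - zs‖ ^ 2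
        ≤ (1 - (μ - η) ^ 2 / (cLip + η) ^ 2) * ‖z k - zs‖ ^ 2 := by
      rw [e, norm_sub_sq_real, inner_smul_right, norm_smul, mul_pow, Real.norm_eq_abs, sq_abs]
      have h6 := mul_le_mul_of_nonneg_left hi ht0
      have h7 := mul_le_mul_of_nonneg_left hn2 (sq_nonneg t)
      have h8 : (1 - (μ - η) ^ 2 / (cLip + η) ^ 2) * ‖z k - zs‖ ^ 2
          = ‖z k - zs‖ ^ 2 - 2 * (t * ((μ - η) * ‖z k - zs‖ ^ 2))
            + t ^ 2 * ((cLip + η) ^ 2 * ‖z k - zs‖ ^ 2) := by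
        rw [ht]; field_simp; ring
      linarith
    refine (pow_le_pow_iff_left₀ (norm_nonneg _) (by positivity) two_ne_zero).mp ?_
    rw [mul_pow, Real.sq_sqrt (by linarith)]
    exact hsq
  intro K
  induction K with
  | zero => simp
  | succ k ih =>
    refine (step k).trans ?_
    rw [pow_succ' _ k, mul_assoc]
    exact mul_le_mul_of_nonneg_left ih (Real.sqrt_nonneg _)
end
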